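/- Let X be a finite set, {|x⟩}_{x∈X} an orthonormal basis of H_A, {|ψ_x⟩}_{x∈X} an orthonormal family in H_B, p a probability mass function on X, and |ξ⟩ = Σ_{x∈X} √p(x) |x⟩ ⊗ |ψ_x⟩. For each type t ∈ P_n(X) with type class T_n(t) of size d_t, fix a bijection e_t : {0,…,d_t − 1} → T_n(t) and define operators on H_A^{⊗n} supported on span{|x^n⟩ : x^n ∈ T_n(t)}: X_t(a) = Σ_{j=0}^{d_t−1} |e_t((j + a) mod d_t)⟩⟨e_t(j)|, Z_t(b) = Σ_{j=0}^{d_t−1} e^{2πi b j / d_t} |e_t(j)⟩⟨e_t(j)|, and Σ_t(a,b) = X_t(a) Z_t(b). For γ = ((a_t, b_t, c_t))_{t ∈ P_n(X)} with a_t, b_t ∈ {0,…,d_t − 1} and c_t ∈ {0,1}, let U(γ) = Σ_{t ∈ P_n(X)} (−1)^{c_t} Σ_t(a_t, b_t) (a block unitary on H_A^{⊗n} restricted to the span of all basis vectors), and let Γ be the set of all such γ. Then (1/|Γ|) Σ_{γ ∈ Γ} (U(γ) ⊗ I) |ξ⟩^{⊗n}⟨ξ|^{⊗n} (U(γ)†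 ⊗ I) = Σ_{t ∈ P_n(X)} P(t) · π_t^A ⊗ π_t^B, where P(t) = d_t · Π_{i=1}^n p((x_t)_i) for any representative x_t^n ∈ T_n(t), π_t^A = d_t^{−1} Σ_{x^n ∈ T_n(t)} |x^n⟩⟨x^n|, and π_t^B = d_t^{−1} Σ_{x^n ∈ T_n(t)} |ψ_{x^n}⟩⟨ψ_{x^n}| (with |x^n⟩ and |ψ_{x^n}⟩ the tensor-product vectors). -/

import Mathlib

open BigOperators Matrix
open scoped Kronecker

noncomputable section

namespace Types

variable {X : Type} [Fintype X] [DecidableEq X]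

/-- The type (empirical occupation counts) of a sequence. -/
def typeOf {n : ℕ} (xn : Fin n → X) : X → ℕ :=
  fun a => (Finset.univ.filter fun i => xn i = a).card

/-- The type class of `t`: all sequences of length `n` with type `t`. -/
def typeClass (n : ℕ) (t : X → ℕ) : Finset (Fin n → X) :=
  Finset.univ.filter fun xn => typeOf xn = t

/-- The set of all types of sequences of length `n`. -/
def types (X : Type) [Fintype X] [DecidableEq X] (n : ℕ) : Finset (X → ℕ) :=
  Finset.image typeOf (Finset.univ : Finset (Fin n → X))

/-- The tensor-product vector `|x^n⟩ = |x_1⟩ ⊗ ⋯ ⊗ |x_n⟩` built from the family `v`. -/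
def vecPow {d : Type} (v : X → d → ℂ) {n : ℕ} (xn : Fin n → X) : (Fin n → d) → ℂ :=
  fun f => ∏ i, v (xn i) (f i)

/-- The probability of the type class of `t` under the i.i.d. law `p`. -/
def Ptype (p : X → ℝ) (n : ℕ) (t : X → ℕ) : ℝ :=
  ∑ xn ∈ typeClass n t, ∏ i, p (xn i)

/-- The rank-one operator `|u⟩⟨u'|`. -/
def outerOp {d : Type} (u u' : d → ℂ) : Matrix d d ℂ :=
  Matrix.of fun f g => u f * (starRingEnd ℂ) (u' g)

variable {dA dB : Type}

/-- The cyclic-shift operator `X_t(a) = Σ_j |e_t(j+a mod d_t)⟩⟨e_t(j)|` on the type-class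
subspace of `t`. -/
def HWX (v : X → dA → ℂ) (n : ℕ)
    (e : (t : X → ℕ) → Fin ((typeClass (X := X) n t).card) ≃
      {xn : Fin n → X // xn ∈ typeClass (X := X) n t})
    (t : X → ℕ) (a : Fin ((typeClass (X := X) n t).card)) :
    Matrix (Fin n → dA) (Fin n → dA) ℂ :=
  ∑ j, outerOp (vecPow v (e t (j + a)).1) (vecPow v (e t j).1)

/-- The phase operator `Z_t(b) = Σ_j e^{2πibj/d_t} |e_t(j)⟩⟨e_t(j)|` on the type-class
subspace of `t`. -/
def HWZ (v : X → dA → ℂ) (n : ℕ)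
    (e : (t : X → ℕ) → Fin ((typeClass (X := X) n t).card) ≃
      {xn : Fin n → X // xn ∈ typeClass (X := X) n t})
    (t : X → ℕ) (b : Fin ((typeClass (X := X) n t).card)) :
    Matrix (Fin n → dA) (Fin n → dA) ℂ :=
  ∑ j : Fin ((typeClass (X := X) n t).card),
    Complex.exp (2 * Real.pi * Complex.I * ((b.val : ℕ) : ℂ) * ((j.val : ℕ) : ℂ) /
      (((typeClass (X := X) n t).card : ℕ) : ℂ)) •
    outerOp (vecPow v (e t j).1) (vecPow v (e t j).1)

/-- The index set `Γ`: for each type `t`, a pair `a_t, b_t ∈ {0,…,d_t−1}` and a sign bit. -/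
abbrev GammaT (X : Type) [Fintype X] [DecidableEq X] (n : ℕ) : Type :=
  (t : {t : X → ℕ // t ∈ types X n}) →
    Fin ((typeClass (X := X) n t.1).card) × Fin ((typeClass (X := X) n t.1).card) × Bool

/-- The block operator `U(γ) = ⊕_t (−1)^{c_t} X_t(a_t) Z_t(b_t)`. -/
def HWU [Fintype dA] (v : X → dA → ℂ) (n : ℕ)
    (e : (t : X → ℕ) → Fin ((typeClass (X := X) n t).card) ≃
      {xn : Fin n → X // xn ∈ typeClass (X := X) n t})
    (γ : GammaT X n) : Matrix (Fin n → dA) (Fin n → dA) ℂ :=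
  ∑ t : {t : X → ℕ // t ∈ types X n},
    (if (γ t).2.2 then (-1 : ℂ) else 1) • (HWX v n e t.1 (γ t).1 * HWZ v n e t.1 (γ t).2.1)

/-- The reordered tensor power `|ξ⟩^{⊗n}` of `|ξ⟩ = Σ_x √p(x) |x⟩ ⊗ |ψ_x⟩`. -/
def xiPow (v : X → dA → ℂ) (w : X → dB → ℂ) (p : X → ℝ) (n : ℕ) :
    ((Fin n → dA) × (Fin n → dB)) → ℂ :=
  fun fg => ∏ i, ∑ x, ((Real.sqrt (p x) : ℝ) : ℂ) * v x (fg.1 i) * w x (fg.2 i)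

set_option linter.unusedSectionVars false

section Sums

/-- Summing a product of a function of one coordinate and a function of the others over a
dependent product type. -/
lemma sum_pi_mul_split {ι : Type} [Fintype ι] [DecidableEq ι] {α : ι → Type}
    [∀ i, Fintype (α i)] (t : ι) (F : α t → ℂ) (G : ((s : {s // s ≠ t}) → α s) → ℂ) :
    ∑ γ : (i : ι) → α i, F (γ t) * G (fun s => γ s) = (∑ a, F a) * ∑ r, G r := by
  rw [Fintype.sum_mul_sum, ← Fintype.sum_prod_type',
    ← (Equiv.piSplitAt t α).sum_comp]
  rfl

lemma card_mul_sum_pi_eval {ι : Type} [Fintype ι] [DecidableEq ι] {α : ι → Type}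
    [∀ i, Fintype (α i)] (t : ι) (F : α t → ℂ) :
    (Fintype.card (α t) : ℂ) * ∑ γ : (i : ι) → α i, F (γ t) =
      (Fintype.card ((i : ι) → α i) : ℂ) * ∑ a, F a := by
  have h := sum_pi_mul_split t F (fun _ => 1)
  have hc := sum_pi_mul_split (α := α) t (fun _ => 1) (fun _ => 1)
  simp only [mul_one, Finset.sum_const, Finset.card_univ, nsmul_eq_mul] at h hc
  rw [h, hc]
  ring

/-- The phase `e^{2πibj/d}`. -/
def phase (d b j : ℕ) : ℂ :=
  Complex.exp (2 * Real.pi * Complex.I * (b : ℂ) * (j : ℂ) / (d : ℂ))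

lemma phase_mul_conj (d b j k : ℕ) :
    phase d b j * (starRingEnd ℂ) (phase d b k) =
      Complex.exp (2 * Real.pi * Complex.I * ((j : ℂ) - k) / d) ^ b := by
  rw [phase, phase, ← Complex.exp_conj, ← Complex.exp_add, ← Complex.exp_nat_mul]
  congr 1
  simp only [map_div₀, map_mul, Complex.conj_ofReal, Complex.conj_I, map_natCast, map_ofNat]
  ring

/-- Orthogonality of the characters of `ℤ/d`. -/
lemma sum_phase_mul_conj {d : ℕ} (j k : Fin d) :
    ∑ b : Fin d, phase d b j * (starRingEnd ℂ) (phase d b k) = if j = k then (d : ℂ) else 0 := by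
  have hd : (d : ℂ) ≠ 0 := Nat.cast_ne_zero.mpr j.pos.ne'
  simp only [phase_mul_conj]
  split_ifs with h
  · subst h
    simp
  rw [Fin.sum_univ_eq_sum_range
    (fun b => Complex.exp (2 * Real.pi * Complex.I * (((j : ℕ) : ℂ) - (k : ℕ)) / d) ^ b) d]
  have h1 : Complex.exp (2 * Real.pi * Complex.I * (((j : ℕ) : ℂ) - (k : ℕ)) / d) ≠ 1 := by
    rw [Ne, Complex.exp_eq_one_iff]
    rintro ⟨m, hm⟩
    have hm' : (((j : ℕ) : ℂ) - (k : ℕ)) = m * d := by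
      have := Complex.two_pi_I_ne_zero
      field_simp at hm
      rw [hm, mul_comm]
    have hz : ((j : ℕ) : ℤ) - (k : ℕ) = m * d := by exact_mod_cast hm'
    have h0 : ((j : ℕ) : ℤ) - (k : ℕ) = 0 :=
      Int.eq_zero_of_abs_lt_dvd (m := (d : ℤ)) ⟨m, by rw [hz, mul_comm]⟩
        (by rw [abs_lt]; omega)
    exact h (Fin.ext (by omega))
  rw [geom_sum_eq h1, ← Complex.exp_nat_mul]
  have h2 : Complex.exp ((d : ℂ) * (2 * Real.pi * Complex.I * (((j : ℕ) : ℂ) - (k : ℕ)) / d)) = 1 :=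
    Complex.exp_eq_one_iff.mpr ⟨(j : ℕ) - (k : ℕ), by push_cast; field_simp⟩
  rw [h2, sub_self, zero_div]

lemma sum_shift_fin {d : ℕ} (j : Fin d) (F : Fin d → ℂ) : ∑ a, F (j + a) = ∑ a, F a := by
  have : NeZero d := ⟨j.pos.ne'⟩
  exact Equiv.sum_comp (Equiv.addLeft j) F

end Sums

section TypeClasses

variable {n : ℕ}

lemma mem_typeClass {t : X → ℕ} {xn : Fin n → X} : xn ∈ typeClass n t ↔ typeOf xn = t := by
  simp [typeClass]

lemma typeOf_mem_types (xn : Fin n → X) : typeOf xn ∈ types X n :=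
  Finset.mem_image_of_mem _ (Finset.mem_univ _)

lemma typeOf_enum (e : (t : X → ℕ) → Fin ((typeClass (X := X) n t).card) ≃
      {xn : Fin n → X // xn ∈ typeClass (X := X) n t}) (t : X → ℕ)
    (j : Fin ((typeClass (X := X) n t).card)) : typeOf (e t j).1 = t :=
  mem_typeClass.mp (e t j).2

lemma sum_typeClass_eq_enum (e : (t : X → ℕ) → Fin ((typeClass (X := X) n t).card) ≃
      {xn : Fin n → X // xn ∈ typeClass (X := X) n t}) {M : Type} [AddCommMonoid M]
    (t : X → ℕ) (F : (Fin n → X) → M) :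
    ∑ xn ∈ typeClass n t, F xn = ∑ j, F (e t j).1 := by
  rw [← Finset.sum_coe_sort, ← (e t).sum_comp]

lemma sum_eq_sum_enum (e : (t : X → ℕ) → Fin ((typeClass (X := X) n t).card) ≃
      {xn : Fin n → X // xn ∈ typeClass (X := X) n t}) {M : Type} [AddCommMonoid M]
    (F : (Fin n → X) → M) :
    ∑ xn, F xn = ∑ t : {t : X → ℕ // t ∈ types X n}, ∑ j, F (e t.1 j).1 := by
  simp only [← sum_typeClass_eq_enum e]
  rw [Finset.sum_coe_sort (types X n) (fun t => ∑ xn ∈ typeClass n t, F xn)]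
  exact (Finset.sum_fiberwise_of_maps_to (fun xn _ => typeOf_mem_types xn) F).symm

lemma prod_eq_prod_pow_typeOf (p : X → ℝ) (xn : Fin n → X) :
    ∏ i, p (xn i) = ∏ a, p a ^ typeOf xn a := by
  rw [← Finset.prod_fiberwise' Finset.univ xn p]
  simp [typeOf]

/-- All sequences of a given type are equally likely. -/
lemma Ptype_eq_card_mul (p : X → ℝ) {t : X → ℕ} {xn : Fin n → X} (hx : typeOf xn = t) :
    Ptype p n t = (typeClass (X := X) n t).card * ∏ i, p (xn i) := by
  rw [Ptype, Finset.sum_congr rfl (g := fun _ => ∏ i, p (xn i)), Finset.sum_const, nsmul_eq_mul]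
  intro yn hy
  rw [prod_eq_prod_pow_typeOf, prod_eq_prod_pow_typeOf, mem_typeClass.mp hy, hx]

end TypeClasses

section Operators

variable {n : ℕ}

lemma star_vecPow_dotProduct [Fintype dA] {v : X → dA → ℂ}
    (hv : ∀ x y, (∑ a, (starRingEnd ℂ) (v x a) * v y a) = if x = y then 1 else 0)
    (xn yn : Fin n → X) :
    star (vecPow v xn) ⬝ᵥ vecPow v yn = if xn = yn then 1 else 0 := by
  classical
  have h : star (vecPow v xn) ⬝ᵥ vecPow v yn =
      ∏ i, ∑ a, (starRingEnd ℂ) (v (xn i) a) * v (yn i) a := by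
    rw [Fintype.prod_sum]
    simp [dotProduct, vecPow, Finset.prod_mul_distrib]
  rw [h]
  simp only [hv, funext_iff]
  by_cases hxy : ∀ i, xn i = yn i
  · simp [hxy]
  · rw [if_neg hxy]
    push Not at hxy
    obtain ⟨i, hi⟩ := hxy
    exact Finset.prod_eq_zero (Finset.mem_univ i) (if_neg hi)

lemma outerOp_mulVec {d : Type} [Fintype d] (u u' z : d → ℂ) :
    outerOp u u' *ᵥ z = (star u' ⬝ᵥ z) • u := by
  ext f
  simp only [outerOp, Matrix.mulVec, dotProduct, Matrix.of_apply, Pi.smul_apply, smul_eq_mul,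
    Finset.sum_mul, Pi.star_apply, starRingEnd_apply]
  exact Finset.sum_congr rfl fun _ _ => by ring

variable [Fintype dA] {v : X → dA → ℂ}
  (e : (t : X → ℕ) → Fin ((typeClass (X := X) n t).card) ≃
    {xn : Fin n → X // xn ∈ typeClass (X := X) n t})

lemma HWX_mulVec
    (hv : ∀ x y, (∑ a, (starRingEnd ℂ) (v x a) * v y a) = if x = y then 1 else 0)
    (t : X → ℕ) (a j : Fin ((typeClass (X := X) n t).card)) :
    HWX v n e t a *ᵥ vecPow v (e t j).1 = vecPow v (e t (j + a)).1 := by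
  simp only [HWX, Matrix.sum_mulVec, outerOp_mulVec, star_vecPow_dotProduct hv]
  rw [Finset.sum_eq_single j]
  · simp
  · intro k _ hk
    rw [if_neg, zero_smul]
    exact fun h => hk ((e t).injective (Subtype.ext h))
  · simp

lemma HWZ_mulVec
    (hv : ∀ x y, (∑ a, (starRingEnd ℂ) (v x a) * v y a) = if x = y then 1 else 0)
    (t : X → ℕ) (b j : Fin ((typeClass (X := X) n t).card)) :
    HWZ v n e t b *ᵥ vecPow v (e t j).1 =
      phase (typeClass (X := X) n t).card b j • vecPow v (e t j).1 := by
  simp only [HWZ, Matrix.sum_mulVec, Matrix.smul_mulVec, outerOp_mulVec,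
    star_vecPow_dotProduct hv]
  rw [Finset.sum_eq_single j]
  · simp [phase]
  · intro k _ hk
    rw [if_neg, zero_smul, smul_zero]
    exact fun h => hk ((e t).injective (Subtype.ext h))
  · simp

lemma HWZ_mulVec_of_ne
    (hv : ∀ x y, (∑ a, (starRingEnd ℂ) (v x a) * v y a) = if x = y then 1 else 0)
    {t : X → ℕ} (b : Fin ((typeClass (X := X) n t).card)) {xn : Fin n → X}
    (hx : typeOf xn ≠ t) : HWZ v n e t b *ᵥ vecPow v xn = 0 := by
  simp only [HWZ, Matrix.sum_mulVec, Matrix.smul_mulVec, outerOp_mulVec,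
    star_vecPow_dotProduct hv]
  refine Finset.sum_eq_zero fun k _ => ?_
  rw [if_neg, zero_smul, smul_zero]
  rintro rfl
  exact hx (typeOf_enum e t k)

/-- The image of `|e_t(j)⟩` under the signed Heisenberg–Weyl operator with parameters `(a, b, c)`. -/
def hwImage (v : X → dA → ℂ) (e : (t : X → ℕ) → Fin ((typeClass (X := X) n t).card) ≃
      {xn : Fin n → X // xn ∈ typeClass (X := X) n t}) (t : X → ℕ)
    (j : Fin ((typeClass (X := X) n t).card))
    (q : Fin ((typeClass (X := X) n t).card) × Fin ((typeClass (X := X) n t).card) × Bool)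
    (f : Fin n → dA) : ℂ :=
  (if q.2.2 then (-1 : ℂ) else 1) *
    (phase (typeClass (X := X) n t).card q.2.1 j * vecPow v (e t (j + q.1)).1 f)

lemma HWU_mulVec
    (hv : ∀ x y, (∑ a, (starRingEnd ℂ) (v x a) * v y a) = if x = y then 1 else 0)
    (γ : GammaT X n) (t : {t : X → ℕ // t ∈ types X n})
    (j : Fin ((typeClass (X := X) n t.1).card)) :
    HWU v n e γ *ᵥ vecPow v (e t.1 j).1 = hwImage v e t.1 j (γ t) := by
  simp only [HWU, Matrix.sum_mulVec, Matrix.smul_mulVec, ← Matrix.mulVec_mulVec]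
  rw [Finset.sum_eq_single t]
  · rw [HWZ_mulVec e hv, Matrix.mulVec_smul, HWX_mulVec e hv]
    rfl
  · intro s _ hs
    rw [HWZ_mulVec_of_ne e hv, Matrix.mulVec_zero, smul_zero]
    rw [typeOf_enum]
    exact fun h => hs (Subtype.ext h.symm)
  · simp

lemma sum_hwImage (t : X → ℕ) (j : Fin ((typeClass (X := X) n t).card)) (f : Fin n → dA) :
    ∑ q, hwImage v e t j q f = 0 := by
  simp [hwImage, Fintype.sum_prod_type]

lemma sum_hwImage_mul_conj (t : X → ℕ) (j k : Fin ((typeClass (X := X) n t).card))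
    (f f' : Fin n → dA) :
    ∑ q, hwImage v e t j q f * (starRingEnd ℂ) (hwImage v e t k q f') =
      if j = k then 2 * ((typeClass (X := X) n t).card : ℂ) *
        ∑ xn ∈ typeClass n t, vecPow v xn f * (starRingEnd ℂ) (vecPow v xn f') else 0 := by
  have h : ∀ q, hwImage v e t j q f * (starRingEnd ℂ) (hwImage v e t k q f') =
      (phase (typeClass (X := X) n t).card q.2.1 j *
          (starRingEnd ℂ) (phase (typeClass (X := X) n t).card q.2.1 k)) *
        (vecPow v (e t (j + q.1)).1 f * (starRingEnd ℂ) (vecPow v (e t (k + q.1)).1 f')) := by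
    rintro ⟨a, b, c⟩
    cases c <;> simp [hwImage] <;> ring
  simp only [h, Fintype.sum_prod_type, Finset.sum_const, Finset.card_univ, Fintype.card_bool,
    nsmul_eq_mul, ← Finset.sum_mul, ← Finset.mul_sum, sum_phase_mul_conj]
  split_ifs with hjk
  · subst hjk
    rw [sum_typeClass_eq_enum e, sum_shift_fin j
      (fun a => vecPow v (e t a).1 f * (starRingEnd ℂ) (vecPow v (e t a).1 f'))]
    push_cast
    ring
  · simp

/-- The averaged second moments of the images of the basis vectors. -/
lemma sum_gamma_hwImage (t s : {t : X → ℕ // t ∈ types X n})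
    (j : Fin ((typeClass (X := X) n t.1).card)) (k : Fin ((typeClass (X := X) n s.1).card))
    (f f' : Fin n → dA) :
    ∑ γ : GammaT X n, hwImage v e t.1 j (γ t) f * (starRingEnd ℂ) (hwImage v e s.1 k (γ s) f') =
      if (e t.1 j).1 = (e s.1 k).1 then (Fintype.card (GammaT X n) : ℂ) *
        (((typeClass (X := X) n t.1).card : ℂ)⁻¹ *
        ∑ xn ∈ typeClass n t.1, vecPow v xn f * (starRingEnd ℂ) (vecPow v xn f')) else 0 := by
  by_cases hts : s = t
  · subst hts
    have hd : ((typeClass (X := X) n s.1).card : ℂ) ≠ 0 := Nat.cast_ne_zero.mpr j.pos.ne'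
    have h := card_mul_sum_pi_eval
      (α := fun t : {t : X → ℕ // t ∈ types X n} => Fin ((typeClass (X := X) n t.1).card) ×
        Fin ((typeClass (X := X) n t.1).card) × Bool) s
      (fun q => hwImage v e s.1 j q f * (starRingEnd ℂ) (hwImage v e s.1 k q f'))
    rw [sum_hwImage_mul_conj] at h
    simp only [Fintype.card_prod, Fintype.card_fin, Fintype.card_bool] at h
    push_cast at h
    have hiff : (e s.1 j).1 = (e s.1 k).1 ↔ j = k :=
      ⟨fun h => (e s.1).injective (Subtype.ext h), fun h => by rw [h]⟩
    simp only [hiff]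
    apply mul_left_cancel₀ (mul_ne_zero hd (mul_ne_zero hd two_ne_zero))
    refine h.trans ?_
    split_ifs
    · field_simp
    · simp
  · rw [if_neg]
    · have h := sum_pi_mul_split
        (α := fun t : {t : X → ℕ // t ∈ types X n} => Fin ((typeClass (X := X) n t.1).card) ×
          Fin ((typeClass (X := X) n t.1).card) × Bool) t
        (fun q => hwImage v e t.1 j q f)
        (fun r => (starRingEnd ℂ) (hwImage v e s.1 k (r ⟨s, hts⟩) f'))
      rw [sum_hwImage, zero_mul] at h
      exact h
    · intro h
      have := congrArg typeOf h
      rw [typeOf_enum, typeOf_enum] at this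
      exact hts (Subtype.ext this.symm)

lemma xiPow_eq_sum (w : X → dB → ℂ) (p : X → ℝ) (f : Fin n → dA) (g : Fin n → dB) :
    xiPow v w p n (f, g) =
      ∑ xn : Fin n → X, ((∏ i, Real.sqrt (p (xn i)) : ℝ) : ℂ) * vecPow v xn f * vecPow w xn g := by
  classical
  simp only [xiPow, vecPow]
  rw [Fintype.prod_sum]
  simp [Finset.prod_mul_distrib]

lemma HWU_kronecker_mulVec_xiPow
    (hv : ∀ x y, (∑ a, (starRingEnd ℂ) (v x a) * v y a) = if x = y then 1 else 0)
    [Fintype dB] [DecidableEq dB] (w : X → dB → ℂ) (p : X → ℝ)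
    (γ : GammaT X n) (f : Fin n → dA) (g : Fin n → dB) :
    ((HWU v n e γ ⊗ₖ (1 : Matrix (Fin n → dB) (Fin n → dB) ℂ)) *ᵥ xiPow v w p n) (f, g) =
      ∑ t : {t : X → ℕ // t ∈ types X n}, ∑ j,
        ((∏ i, Real.sqrt (p ((e t.1 j).1 i)) : ℝ) : ℂ) * vecPow w (e t.1 j).1 g *
          hwImage v e t.1 j (γ t) f := by
  have h : ((HWU v n e γ ⊗ₖ (1 : Matrix (Fin n → dB) (Fin n → dB) ℂ)) *ᵥ xiPow v w p n) (f, g) =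
      ∑ xn : Fin n → X, ((∏ i, Real.sqrt (p (xn i)) : ℝ) : ℂ) * vecPow w xn g *
        (HWU v n e γ *ᵥ vecPow v xn) f := by
    simp only [Matrix.mulVec, dotProduct, Fintype.sum_prod_type, Matrix.kroneckerMap_apply,
      Matrix.one_apply, mul_ite, mul_one, mul_zero, ite_mul, zero_mul, Finset.sum_ite_eq,
      Finset.mem_univ, if_true, xiPow_eq_sum, Finset.mul_sum]
    rw [Finset.sum_comm]
    exact Finset.sum_congr rfl fun _ _ => Finset.sum_congr rfl fun _ _ => by ring
  rw [h, sum_eq_sum_enum e]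
  simp only [HWU_mulVec e hv]

end Operators

/-- **Twirling a tensor-power entangled state by the type-wise Heisenberg–Weyl group**: the
average of `(U(γ) ⊗ I) |ξ⟩^{⊗n}⟨ξ|^{⊗n} (U(γ)† ⊗ I)` over `γ ∈ Γ` equals
`Σ_t P(t) π_t^A ⊗ π_t^B`, the mixture of maximally mixed states on the type-class
subspaces. -/
theorem hw_twirl_tensor_power [Fintype dA] [Fintype dB] [DecidableEq dA] [DecidableEq dB]
    (v : X → dA → ℂ) (w : X → dB → ℂ)
    (hv : ∀ x y, (∑ a, (starRingEnd ℂ) (v x a) * v y a) = if x = y then 1 else 0)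
    (hw : ∀ x y, (∑ b, (starRingEnd ℂ) (w x b) * w y b) = if x = y then 1 else 0)
    (p : X → ℝ) (hp : ∀ x, 0 ≤ p x) (hp1 : (∑ x, p x) = 1) (n : ℕ)
    (e : (t : X → ℕ) → Fin ((typeClass (X := X) n t).card) ≃
      {xn : Fin n → X // xn ∈ typeClass (X := X) n t}) :
    ((Fintype.card (GammaT X n) : ℂ))⁻¹ •
      (∑ γ : GammaT X n,
        (HWU v n e γ ⊗ₖ (1 : Matrix (Fin n → dB) (Fin n → dB) ℂ)) *
          (Matrix.of fun fg fg' : (Fin n → dA) × (Fin n → dB) =>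
            xiPow v w p n fg * (starRingEnd ℂ) (xiPow v w p n fg')) *
        (HWU v n e γ ⊗ₖ (1 : Matrix (Fin n → dB) (Fin n → dB) ℂ))ᴴ) =
    ∑ t ∈ types X n, ((Ptype p n t : ℝ) : ℂ) •
      (((((typeClass (X := X) n t).card : ℕ) : ℂ)⁻¹ •
          ∑ xn ∈ typeClass (X := X) n t, outerOp (vecPow v xn) (vecPow v xn)) ⊗ₖ
        ((((typeClass (X := X) n t).card : ℕ) : ℂ)⁻¹ •
          ∑ xn ∈ typeClass (X := X) n t, outerOp (vecPow w xn) (vecPow w xn))) := by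
  have hrank (γ : GammaT X n) (f f' : Fin n → dA) (g g' : Fin n → dB) :
      ((HWU v n e γ ⊗ₖ (1 : Matrix (Fin n → dB) (Fin n → dB) ℂ)) *
          (Matrix.of fun fg fg' : (Fin n → dA) × (Fin n → dB) =>
            xiPow v w p n fg * (starRingEnd ℂ) (xiPow v w p n fg')) *
        (HWU v n e γ ⊗ₖ (1 : Matrix (Fin n → dB) (Fin n → dB) ℂ))ᴴ) (f, g) (f', g') =
      ((HWU v n e γ ⊗ₖ (1 : Matrix (Fin n → dB) (Fin n → dB) ℂ)) *ᵥ xiPow v w p n) (f, g) *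
        (starRingEnd ℂ) (((HWU v n e γ ⊗ₖ (1 : Matrix (Fin n → dB) (Fin n → dB) ℂ)) *ᵥ
          xiPow v w p n) (f', g')) := by
    have hξ : (Matrix.of fun fg fg' : (Fin n → dA) × (Fin n → dB) =>
        xiPow v w p n fg * (starRingEnd ℂ) (xiPow v w p n fg')) =
        Matrix.vecMulVec (xiPow v w p n) (star (xiPow v w p n)) := rfl
    rw [hξ, Matrix.mul_vecMulVec, Matrix.vecMulVec_mul, ← Matrix.star_mulVec]
    rfl
  ext ⟨f, g⟩ ⟨f', g'⟩
  simp only [Matrix.smul_apply, Matrix.sum_apply, hrank, HWU_kronecker_mulVec_xiPow e hv]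
  have hcard : (Fintype.card (GammaT X n) : ℂ) ≠ 0 := by
    have : Nonempty (GammaT X n) := by
      refine ⟨fun t => ?_⟩
      have hx := (Finset.mem_image.mp t.2).choose_spec.2
      have j := (e t.1).symm ⟨_, mem_typeClass.mpr hx⟩
      exact (j, j, false)
    exact Nat.cast_ne_zero.mpr Fintype.card_ne_zero
  have hswap : ∑ γ : GammaT X n,
      (∑ t : {t : X → ℕ // t ∈ types X n}, ∑ j,
        ((∏ i, Real.sqrt (p ((e t.1 j).1 i)) : ℝ) : ℂ) * vecPow w (e t.1 j).1 g *
          hwImage v e t.1 j (γ t) f) *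
      (starRingEnd ℂ) (∑ t : {t : X → ℕ // t ∈ types X n}, ∑ j,
        ((∏ i, Real.sqrt (p ((e t.1 j).1 i)) : ℝ) : ℂ) * vecPow w (e t.1 j).1 g' *
          hwImage v e t.1 j (γ t) f') =
      ∑ t : {t : X → ℕ // t ∈ types X n}, ∑ j, ∑ s : {t : X → ℕ // t ∈ types X n}, ∑ k,
        (((∏ i, Real.sqrt (p ((e t.1 j).1 i)) : ℝ) : ℂ) * vecPow w (e t.1 j).1 g *
          (((∏ i, Real.sqrt (p ((e s.1 k).1 i)) : ℝ) : ℂ) *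
            (starRingEnd ℂ) (vecPow w (e s.1 k).1 g'))) *
        ∑ γ : GammaT X n, hwImage v e t.1 j (γ t) f *
          (starRingEnd ℂ) (hwImage v e s.1 k (γ s) f') := by
    simp only [map_sum, map_mul, Complex.conj_ofReal, Finset.sum_mul]
    simp only [Finset.mul_sum]
    rw [Finset.sum_comm]
    refine Finset.sum_congr rfl fun t _ => ?_
    rw [Finset.sum_comm]
    refine Finset.sum_congr rfl fun j _ => ?_
    rw [Finset.sum_comm]
    refine Finset.sum_congr rfl fun s _ => ?_
    rw [Finset.sum_comm]
    exact Finset.sum_congr rfl fun k _ => Finset.sum_congr rfl fun γ _ => by ring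
  rw [hswap, smul_eq_mul, Finset.mul_sum, ← Finset.sum_coe_sort (types X n)]
  refine Finset.sum_congr rfl fun t _ => ?_
  simp only [Matrix.smul_apply, Matrix.kroneckerMap_apply, Matrix.sum_apply, outerOp,
    Matrix.of_apply, smul_eq_mul]
  rw [sum_typeClass_eq_enum e t.1 (fun xn => vecPow w xn g * (starRingEnd ℂ) (vecPow w xn g'))]
  simp only [Finset.mul_sum (Finset.univ : Finset (Fin _))]
  refine Finset.sum_congr rfl fun j _ => ?_
  have hd : ((typeClass (X := X) n t.1).card : ℂ) ≠ 0 := Nat.cast_ne_zero.mpr j.pos.ne'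
  have hsq : ((∏ i, Real.sqrt (p ((e t.1 j).1 i)) : ℝ) : ℂ) *
      ((∏ i, Real.sqrt (p ((e t.1 j).1 i)) : ℝ) : ℂ) = ((∏ i, p ((e t.1 j).1 i) : ℝ) : ℂ) := by
    rw [← Complex.ofReal_mul, ← Finset.prod_mul_distrib]
    simp only [Real.mul_self_sqrt (hp _)]
  have hdiag := sum_eq_sum_enum e (fun yn : Fin n → X =>
    (((∏ i, Real.sqrt (p ((e t.1 j).1 i)) : ℝ) : ℂ) * vecPow w (e t.1 j).1 g *
      (((∏ i, Real.sqrt (p (yn i)) : ℝ) : ℂ) * (starRingEnd ℂ) (vecPow w yn g'))) *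
    if (e t.1 j).1 = yn then (Fintype.card (GammaT X n) : ℂ) *
        (((typeClass (X := X) n t.1).card : ℂ)⁻¹ *
        ∑ xn ∈ typeClass n t.1, vecPow v xn f * (starRingEnd ℂ) (vecPow v xn f')) else 0)
  simp only [sum_gamma_hwImage]
  rw [← hdiag]
  simp only [mul_ite, mul_zero, Finset.sum_ite_eq, Finset.mem_univ, if_true]
  rw [Ptype_eq_card_mul p (typeOf_enum e t.1 j), Complex.ofReal_mul, Complex.ofReal_natCast, ← hsq]
  field_simp

end Types
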